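/- arXiv:1604.01173 — 2 statements merged into one kernel-verified Lean document; each statement's English description precedes it below -/
import Mathlib

section
/- Let u, v, β, δ ∈ ℤ with uδ − vβ = 1 and u ≠ 0, let M ≥ 1 and f₂ ≥ 1 be integers, and set r = gcd(v, M), v' = v/r, M' = M/r. Let n ∈ ℤ with n ≠ 0 and gcd(n, f₂) = 1. Then there exists m ∈ ℤ with mMf₂u + nv = 0 if and only if M'u divides n and f₂ divides v'. Moreover, in that case the (unique) such m is m = −(n/(M'u))·(v'/f₂), and it satisfies mMf₂β + nδ = n/u (which is an integer). -/
theorem statement6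
    (u v β δ : ℤ) (hdet : u * δ - v * β = 1) (hu : u ≠ 0)
    (M f₂ : ℤ) (hM : 1 ≤ M) (hf₂ : 1 ≤ f₂)
    (r : ℕ) (hr : r = Int.gcd v M)
    (v' M' : ℤ) (hv' : v' = v / r) (hM' : M' = M / r)
    (n : ℤ) (hn : n ≠ 0) (hnf : Int.gcd n f₂ = 1) :
    ((∃ m : ℤ, m * M * f₂ * u + n * v = 0) ↔ (M' * u ∣ n ∧ f₂ ∣ v')) ∧
    (∀ m : ℤ, m * M * f₂ * u + n * v = 0 →
      m = -(n / (M' * u) * (v' / f₂)) ∧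
      u ∣ n ∧
      m * M * f₂ * β + n * δ = n / u) := by
  have hrpos : 0 < Int.gcd v M := Int.gcd_pos_of_ne_zero_right _ (by omega)
  have hr0 : (r : ℤ) ≠ 0 := by
    rw [hr]; exact_mod_cast hrpos.ne'
  have hvr : v = r * v' := by
    rw [hv', hr, Int.mul_ediv_cancel' (Int.gcd_dvd_left _ _)]
  have hMr : M = r * M' := by
    rw [hM', hr, Int.mul_ediv_cancel' (Int.gcd_dvd_right _ _)]
  have hco : IsCoprime M' v' := by
    have h := Int.gcd_ediv_gcd_ediv_gcd hrpos
    rw [← hr, ← hv', ← hM'] at h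
    exact (Int.isCoprime_iff_gcd_eq_one.mpr h).symm
  have huv : IsCoprime u v' :=
    ⟨δ, -(r * β), by rw [hvr] at hdet; linear_combination hdet⟩
  have hnf' : IsCoprime f₂ n := (Int.isCoprime_iff_gcd_eq_one.mpr hnf).symm
  have hM0 : M' ≠ 0 := by
    rintro h
    rw [h] at hMr
    omega
  have hf0 : f₂ ≠ 0 := by omega
  have key : ∀ m : ℤ, m * M * f₂ * u + n * v = 0 → m * M' * f₂ * u + n * v' = 0 := by
    intro m h
    rw [hvr, hMr] at h
    apply mul_left_cancel₀ hr0
    linear_combination h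
  have fwd : ∀ m : ℤ, m * M * f₂ * u + n * v = 0 → M' * u ∣ n ∧ f₂ ∣ v' := by
    intro m h
    have h2 := key m h
    constructor
    · exact (hco.mul_left huv).dvd_of_dvd_mul_right
        ⟨-(m * f₂), by linear_combination h2⟩
    · exact hnf'.dvd_of_dvd_mul_left ⟨-(m * M' * u), by linear_combination h2⟩
  refine ⟨⟨fun ⟨m, h⟩ => fwd m h, ?_⟩, ?_⟩
  · rintro ⟨⟨k, hk⟩, ⟨w, hw⟩⟩
    refine ⟨-(k * w), ?_⟩
    rw [hvr, hMr, hk, hw]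
    ring
  · intro m h
    have h2 := key m h
    obtain ⟨⟨k, hk⟩, ⟨w, hw⟩⟩ := fwd m h
    refine ⟨?_, ⟨M' * k, by rw [hk]; ring⟩, ?_⟩
    · rw [hk, hw, Int.mul_ediv_cancel_left _ (mul_ne_zero hM0 hu),
        Int.mul_ediv_cancel_left _ hf0]
      apply mul_left_cancel₀ (mul_ne_zero (mul_ne_zero hM0 hf0) hu)
      rw [hk, hw] at h2
      linear_combination h2
    · symm
      apply Int.ediv_eq_of_eq_mul_right hu
      linear_combination (-n) * hdet - β * h
end

section
/- Let l be a prime number and k ≥ 2 an even integer with l > k + 1. Then the classical Bernoulli number B_k ∈ ℚ is l-integral: its l-adic valuation is ≥ 0, i.e., l does not divide the denominator of B_k. -/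
theorem bern_int_aux (l : ℕ) [Fact l.Prime] (n : ℕ) (h : n + 1 < l) :
    ((bernoulli' n : ℚ) : ℚ_[l]) ∈ PadicInt.subring l := by
  induction n using Nat.strong_induction_on with
  | _ n ih =>
    rw [bernoulli'_def]
    push_cast
    refine sub_mem (one_mem _) (sum_mem fun k hk => ?_)
    have hk' : k < n := Finset.mem_range.1 hk
    refine mul_mem ?_ (ih k hk' (by omega))
    rw [div_eq_mul_inv]
    refine mul_mem (natCast_mem _ _) ?_
    have e : ((n : ℚ_[l]) - k + 1) = ((n - k + 1 : ℕ) : ℚ_[l]) := by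
      push_cast [Nat.cast_sub hk'.le]; ring
    rw [e]
    change ‖_‖ ≤ 1
    rw [norm_inv, (Padic.norm_natCast_eq_one_iff).2]
    · simp
    · exact Nat.coprime_of_lt_prime (by omega) (by omega) Fact.out

theorem statement12 (l : ℕ) (hl : l.Prime) (k : ℕ) (hk : 2 ≤ k) (hke : Even k)
    (hlk : k + 1 < l) :
    0 ≤ padicValRat l (bernoulli k) ∧ ¬ l ∣ (bernoulli k).den := by
  haveI : Fact l.Prime := ⟨hl⟩
  have h : ‖((bernoulli' k : ℚ) : ℚ_[l])‖ ≤ 1 := bern_int_aux l k hlk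
  rw [← bernoulli_eq_bernoulli'_of_ne_one (by omega)] at h
  have h2 : 0 ≤ padicValRat l (bernoulli k) := by
    rw [Padic.norm_le_one_iff_val_nonneg, Padic.valuation_ratCast] at h
    exact h
  refine ⟨h2, fun hd => ?_⟩
  have hn : ¬ l ∣ (bernoulli k).num.natAbs := fun hn =>
    Nat.not_coprime_of_dvd_of_dvd hl.one_lt hn hd (bernoulli k).reduced
  have h3 := one_le_padicValNat_of_dvd (bernoulli k).den_nz hd
  rw [padicValRat, padicValInt, padicValNat.eq_zero_of_not_dvd hn] at h2
  omega
end
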